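/- arXiv:1503.05812 — 2 statements merged into one kernel-verified Lean document; each statement's English description precedes it below -/
import Mathlib

section
/- Let d ≥ 2 and k ≥ 1 be integers and 0 < λ < λ_c = d^d/(k(d−1)^{d+1}). With u_1 = kλ, v_1 = 0, u_{ℓ+1} = kλ/(1+v_ℓ)^d, v_{ℓ+1} = kλ/(1+u_ℓ)^d, x̂ the unique positive fixed point of f(x) = kλ/(1+x)^d, and r = d·x̂/(1+x̂) (so r < 1): for every ℓ ≥ 2, u_ℓ − x̂ ≤ kλ·r^{ℓ−2}; for every ℓ ≥ 3, x̂ − v_ℓ ≤ d·k²·λ²·r^{ℓ−3}; and consequently for every ℓ ≥ 3, u_ℓ − v_ℓ ≤ (kλ + d·k²·λ²)·r^{ℓ−3}. In particular the gap u_ℓ − v_ℓ decays exponentially in ℓ. -/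
/-- The derivative of `x ↦ m / (1 + x) ^ d`. -/
lemma hasDerivAt_div_one_add_pow (d : ℕ) (m x : ℝ) (hx : 0 ≤ x) :
    HasDerivAt (fun y : ℝ => m / (1 + y) ^ d) (-(d * m / (1 + x) ^ (d + 1))) x := by
  have h1 : (1 + x) ≠ 0 := by positivity
  have h := (((hasDerivAt_id x).const_add 1).pow d).inv (pow_ne_zero d h1) |>.const_mul m
  refine (h.congr_deriv ?_).congr_of_eventuallyEq ?_
  · rcases d with _ | n
    · simp
    · simp only [id, Nat.add_sub_cancel, Pi.pow_apply]
      field_simp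
      ring
  · exact Filter.Eventually.of_forall fun y => by simp [div_eq_mul_inv]

/-- A positive fixed point of `x ↦ m / (1 + x) ^ d` below the critical `m` is less than
`1 / (d - 1)`. -/
lemma fixedPoint_mul_lt_one_add {d : ℕ} (hd : 2 ≤ d) {m a : ℝ} (ha : 0 < a)
    (hfix : a = m / (1 + a) ^ d) (hm : m < (d : ℝ) ^ d / ((d : ℝ) - 1) ^ (d + 1)) :
    d * a < 1 + a := by
  have hd' : (0 : ℝ) < d - 1 := by
    have : (2 : ℝ) ≤ d := by exact_mod_cast hd
    linarith
  by_contra! hcon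
  have hm' : m = a * (1 + a) ^ d := by
    rw [eq_div_iff (by positivity)] at hfix
    exact hfix.symm
  rw [hm', lt_div_iff₀ (by positivity)] at hm
  have h1 : (1 : ℝ) ≤ a * (d - 1) := by linarith
  have h2 : (d : ℝ) ≤ (1 + a) * (d - 1) := by linarith
  have h3 : (d : ℝ) ^ d ≤ ((1 + a) * (d - 1)) ^ d := pow_le_pow_left₀ (by positivity) h2 d
  have h4 : a * (1 + a) ^ d * ((d : ℝ) - 1) ^ (d + 1)
      = (a * (d - 1)) * ((1 + a) * (d - 1)) ^ d := by rw [mul_pow]; ring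
  rw [h4] at hm
  have h5 : (0 : ℝ) ≤ ((1 + a) * (d - 1)) ^ d := by positivity
  nlinarith

/-- Bernoulli's inequality for `x ↦ m / (1 + x) ^ d` to the right of its fixed point. -/
lemma fixedPoint_bernoulli (d : ℕ) {m a x : ℝ} (ha : 0 < a)
    (hfix : a = m / (1 + a) ^ d) (hx : a ≤ x) :
    a * (1 + x - d * (x - a)) ≤ (1 + x) * (m / (1 + x) ^ d) := by
  have hx1 : 0 < 1 + x := by linarith
  have hm : m = a * (1 + a) ^ d := by
    rw [eq_div_iff (by positivity)] at hfix
    exact hfix.symm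
  have hratio : -1 ≤ (a - x) / (1 + x) := by
    rw [le_div_iff₀ hx1]
    linarith
  have hb := one_add_mul_le_pow (by linarith : -2 ≤ (a - x) / (1 + x)) d
  have he : 1 + (a - x) / (1 + x) = (1 + a) / (1 + x) := by field_simp; ring
  rw [he, div_pow] at hb
  calc a * (1 + x - d * (x - a)) = a * (1 + x) * (1 + d * ((a - x) / (1 + x))) := by
        field_simp
        ring
    _ ≤ a * (1 + x) * ((1 + a) ^ d / (1 + x) ^ d) := by gcongr
    _ = (1 + x) * (m / (1 + x) ^ d) := by rw [hm]; ring

/-- The map `x ↦ m / (1 + x) ^ d` contracts to the right of its fixed point at most at the rate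
of its derivative there. -/
lemma fixedPoint_sub_le (d : ℕ) {m a x : ℝ} (ha : 0 < a)
    (hfix : a = m / (1 + a) ^ d) (hx : a ≤ x) :
    a - m / (1 + x) ^ d ≤ d * a / (1 + a) * (x - a) := by
  have hx1 : 0 < 1 + x := by linarith
  have h := fixedPoint_bernoulli d ha hfix hx
  have h1 : a - m / (1 + x) ^ d ≤ d * a * (x - a) / (1 + x) := by
    rw [le_div_iff₀ hx1]
    linarith
  refine h1.trans ?_
  rw [div_mul_eq_mul_div]
  have : 0 ≤ x - a := by linarith
  gcongr

/-- The second iterate of `x ↦ m / (1 + x) ^ d` contracts to the right of the fixed point at the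
rate of its derivative there. -/
lemma iterate_two_sub_fixedPoint_le (d : ℕ) {m a x : ℝ} (hm : 0 < m) (ha : 0 < a)
    (hfix : a = m / (1 + a) ^ d) (hda : d * a < 1 + a) (hx : a ≤ x) :
    m / (1 + m / (1 + x) ^ d) ^ d - a ≤ (d * a / (1 + a)) ^ 2 * (x - a) := by
  set f : ℝ → ℝ := fun y => m / (1 + y) ^ d
  have hder : ∀ y, 0 ≤ y → HasDerivAt (fun z => f (f z))
      (-(d * m / (1 + f y) ^ (d + 1)) * -(d * m / (1 + y) ^ (d + 1))) y := fun y hy =>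
    (hasDerivAt_div_one_add_pow d m (f y) (by positivity)).comp y
      (hasDerivAt_div_one_add_pow d m y hy)
  have hbound : ∀ y, a ≤ y →
      -(d * m / (1 + f y) ^ (d + 1)) * -(d * m / (1 + y) ^ (d + 1)) ≤ (d * a / (1 + a)) ^ 2 := by
    intro y hy
    have hy0 : 0 ≤ y := ha.le.trans hy
    have hfy : 0 < f y := by positivity
    have hprod : (1 + a) ^ 2 ≤ (1 + f y) * (1 + y) := by
      have hb := fixedPoint_bernoulli d ha hfix hy
      have : 0 ≤ (y - a) * (1 + a - d * a) := mul_nonneg (by linarith) (by linarith)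
      change _ ≤ (1 + y) * f y at hb
      nlinarith
    have hra : d * a / (1 + a) = d * m / (1 + a) ^ (d + 1) := by
      rw [pow_succ, mul_div_assoc, mul_div_assoc]
      nth_rewrite 1 [hfix]
      field_simp
    calc -(d * m / (1 + f y) ^ (d + 1)) * -(d * m / (1 + y) ^ (d + 1))
        = (d * m) ^ 2 / ((1 + f y) * (1 + y)) ^ (d + 1) := by
          rw [mul_pow (1 + f y), neg_mul_neg, div_mul_div_comm, sq]
      _ ≤ (d * m) ^ 2 / ((1 + a) ^ 2) ^ (d + 1) := by gcongr
      _ = (d * a / (1 + a)) ^ 2 := by rw [hra, div_pow, ← pow_mul, ← pow_mul, mul_comm 2]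
  have hffa : f (f a) = a := by
    have : f a = a := hfix.symm
    rw [this, this]
  have key := (convex_Ici a).image_sub_le_mul_sub_of_deriv_le (f := fun z => f (f z))
    (fun y hy => (hder y (ha.le.trans hy)).continuousAt.continuousWithinAt)
    (fun y hy => (hder y (ha.le.trans (interior_subset hy))).differentiableAt.differentiableWithinAt)
    (C := (d * a / (1 + a)) ^ 2)
    (fun y hy => by
      rw [(hder y (ha.le.trans (interior_subset hy))).deriv]
      exact hbound y (interior_subset hy))
    a Set.self_mem_Ici x hx hx
  simpa only [hffa] using key


/-- For `d ≥ 2`, `k ≥ 1`, `0 < λ < λ_c`, with `u_ℓ, v_ℓ` the extremal recursion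
sequences, `x̂` the unique positive fixed point of `f(x) = kλ/(1+x)^d` and
`r = d·x̂/(1+x̂) < 1`: for `ℓ ≥ 2`, `u_ℓ − x̂ ≤ kλ·r^(ℓ−2)`; for `ℓ ≥ 3`,
`x̂ − v_ℓ ≤ d·k²·λ²·r^(ℓ−3)`; and for `ℓ ≥ 3`, `u_ℓ − v_ℓ ≤ (kλ + d·k²·λ²)·r^(ℓ−3)`. -/
theorem stmt8 (d k : ℕ) (hd : 2 ≤ d) (hk : 1 ≤ k) (lam : ℝ) (hlam : 0 < lam)
    (hlt : lam < (d : ℝ) ^ d / ((k : ℝ) * ((d : ℝ) - 1) ^ (d + 1)))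
    (xhat : ℝ) (hx : 0 < xhat) (hfix : xhat = (k : ℝ) * lam / (1 + xhat) ^ d)
    (u v : ℕ → ℝ) (hu1 : u 1 = (k : ℝ) * lam) (hv1 : v 1 = 0)
    (hu : ∀ ℓ, 1 ≤ ℓ → u (ℓ + 1) = (k : ℝ) * lam / (1 + v ℓ) ^ d)
    (hv : ∀ ℓ, 1 ≤ ℓ → v (ℓ + 1) = (k : ℝ) * lam / (1 + u ℓ) ^ d)
    (r : ℝ) (hr : r = (d : ℝ) * xhat / (1 + xhat)) :
    r < 1 ∧
    (∀ ℓ, 2 ≤ ℓ → u ℓ - xhat ≤ (k : ℝ) * lam * r ^ (ℓ - 2)) ∧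
    (∀ ℓ, 3 ≤ ℓ → xhat - v ℓ ≤ (d : ℝ) * (k : ℝ) ^ 2 * lam ^ 2 * r ^ (ℓ - 3)) ∧
    (∀ ℓ, 3 ≤ ℓ →
      u ℓ - v ℓ ≤ ((k : ℝ) * lam + (d : ℝ) * (k : ℝ) ^ 2 * lam ^ 2) * r ^ (ℓ - 3)) := by
  set m : ℝ := k * lam with hmdef
  have hk0 : (0 : ℝ) < k := by exact_mod_cast hk
  have hm : 0 < m := by positivity
  have hd1 : (0 : ℝ) < d - 1 := by
    have : (2 : ℝ) ≤ d := by exact_mod_cast hd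
    linarith
  have hmlt : m < (d : ℝ) ^ d / ((d : ℝ) - 1) ^ (d + 1) := by
    rw [lt_div_iff₀ (by positivity)] at hlt ⊢
    calc m * ((d : ℝ) - 1) ^ (d + 1) = lam * (k * ((d : ℝ) - 1) ^ (d + 1)) := by rw [hmdef]; ring
      _ < _ := hlt
  have hda := fixedPoint_mul_lt_one_add hd hx hfix hmlt
  have hr1 : r < 1 := by
    rw [hr, div_lt_one (by positivity)]
    exact hda
  have hr0 : 0 ≤ r := by rw [hr]; positivity
  have hxm : xhat ≤ m := by
    rw [hfix]
    exact div_le_self hm.le (one_le_pow₀ (by linarith))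
  have hrm : r ≤ d * m := by
    rw [hr]
    exact (div_le_self (by positivity) (by linarith)).trans (by gcongr)
  have horder : ∀ ℓ, 1 ≤ ℓ → xhat ≤ u ℓ ∧ 0 ≤ v ℓ ∧ v ℓ ≤ xhat := by
    intro ℓ hℓ
    induction ℓ, hℓ using Nat.le_induction with
    | base => exact ⟨hu1 ▸ hxm, hv1.ge, hv1 ▸ hx.le⟩
    | succ n hn ih =>
      obtain ⟨h1, h2, h3⟩ := ih
      have h4 : 0 < 1 + u n := by linarith
      rw [hu n hn, hv n hn]
      refine ⟨?_, by positivity, ?_⟩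
      · calc xhat = m / (1 + xhat) ^ d := hfix
          _ ≤ _ := by gcongr
      · calc m / (1 + u n) ^ d ≤ m / (1 + xhat) ^ d := by gcongr
          _ = xhat := hfix.symm
  have hstep : ∀ ℓ, 1 ≤ ℓ → u (ℓ + 2) - xhat ≤ r ^ 2 * (u ℓ - xhat) := by
    intro ℓ hℓ
    rw [hu (ℓ + 1) (by omega), hv ℓ hℓ, hr]
    exact iterate_two_sub_fixedPoint_le d hm hx hfix hda (horder ℓ hℓ).1
  have hupper : ∀ n, u (n + 2) - xhat ≤ m * r ^ n := by
    intro n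
    induction n using Nat.strong_induction_on with
    | _ n ih =>
      match n with
      | 0 =>
        have : u 2 = m := by rw [hu 1 le_rfl, hv1]; simp
        simp only [Nat.zero_add, this, pow_zero, mul_one]
        linarith
      | 1 =>
        have h := hstep 1 le_rfl
        rw [hu1] at h
        have h1 : r ^ 2 * (m - xhat) ≤ r * m :=
          mul_le_mul (by nlinarith) (by linarith) (by linarith) hr0
        rw [pow_one, mul_comm]
        exact h.trans h1
      | n + 2 =>
        calc u (n + 2 + 2) - xhat ≤ r ^ 2 * (u (n + 2) - xhat) := hstep (n + 2) (by omega)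
          _ ≤ r ^ 2 * (m * r ^ n) := by gcongr; exact ih n (by omega)
          _ = m * r ^ (n + 2) := by ring
  have hlower : ∀ n, xhat - v (n + 3) ≤ d * (k : ℝ) ^ 2 * lam ^ 2 * r ^ n := by
    intro n
    rw [hv (n + 2) (by omega)]
    have h0 : 0 ≤ u (n + 2) - xhat := by linarith [(horder (n + 2) (by omega)).1]
    calc xhat - m / (1 + u (n + 2)) ^ d ≤ r * (u (n + 2) - xhat) := by
          rw [hr]
          exact fixedPoint_sub_le d hx hfix (horder (n + 2) (by omega)).1
      _ ≤ (d * m) * (m * r ^ n) := by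
          gcongr
          exact hupper n
      _ = d * (k : ℝ) ^ 2 * lam ^ 2 * r ^ n := by rw [hmdef]; ring
  refine ⟨hr1, fun ℓ hℓ => ?_, fun ℓ hℓ => ?_, fun ℓ hℓ => ?_⟩
  · obtain ⟨n, rfl⟩ := Nat.exists_eq_add_of_le' hℓ
    exact hupper n
  · obtain ⟨n, rfl⟩ := Nat.exists_eq_add_of_le' hℓ
    exact hlower n
  · obtain ⟨n, rfl⟩ := Nat.exists_eq_add_of_le' hℓ
    have h1 : m * r ^ (n + 1) ≤ m * r ^ n := by
      gcongr ?_ * ?_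
      exact pow_le_pow_of_le_one hr0 hr1.le (Nat.le_succ n)
    have h2 := hupper (n + 1)
    have h3 := hlower n
    rw [Nat.add_sub_cancel, add_mul]
    linarith
end

section
/- Fix integers d, k ≥ 1 and real λ > 0. Encode the vertices of the (k+1)-uniform (d+1)-regular hypertree as: the root, together with nodes (i₀, j₀, w) where i₀ ∈ Fin (d+1), j₀ ∈ Fin k and w is a finite list over (Fin d × Fin k); the root has d+1 child-hyperedges each containing k children, and every other vertex has d child-hyperedges each containing k children. For ℓ ≥ 1 and an activity assignment λ⃗ with 0 ≤ λ⃗(v) ≤ λ for every node v, define values in [0,∞] by downward recursion: nodes at depth ℓ get the boundary value; a non-root node v at depth m < ℓ gets R(v) = λ⃗(v) · ∏_{i∈Fin d} (1 + Σ_{j∈Fin k} R(child (i,j) of v))⁻¹; the root gets R = λ⃗(root) · ∏_{i∈Fin (d+1)} (1 + Σ_{j∈Fin k} R(child (i,j)))⁻¹. Let R⁺_ℓ(λ⃗) be the root value with boundary ∞ when ℓ is even and 0 when ℓ is odd, R⁻_ℓ(λ⃗) the root value with the opposite boundary, and R⁺_ℓ, R⁻_ℓ the values for the constant assignment λ⃗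 ≡ λ. Then for every ℓ ≥ 1, R⁺_ℓ(λ⃗) · R⁻_ℓ ≤ R⁺_ℓ · R⁻_ℓ(λ⃗). -/
open scoped ENNReal

/-- Value at a node of a `(k+1)`-uniform `d`-ary subtree, computed by downward recursion in
`ℝ≥0∞` (same recursion as for the `d`-ary hypertree): nodes are lists over `Fin d × Fin k`,
`lam` assigns activities, `b` is the boundary value at remaining depth `0`, and a node `v`
with remaining depth `n+1` gets `lam v · ∏_{i : Fin d} (1 + ∑_{j : Fin k} child value)⁻¹`. -/
noncomputable def subTreeR (d k : ℕ) (lam : List (Fin d × Fin k) → ℝ) (b : ℝ≥0∞) :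
    ℕ → List (Fin d × Fin k) → ℝ≥0∞
  | 0, _ => b
  | n + 1, v =>
      ENNReal.ofReal (lam v) *
        ∏ i : Fin d, (1 + ∑ j : Fin k, subTreeR d k lam b n (v ++ [(i, j)]))⁻¹

/-- Root value of the `(k+1)`-uniform `(d+1)`-regular hypertree truncated at depth `ℓ ≥ 1`,
with boundary value `b` at depth `ℓ`.  Vertices are `Option (Fin (d+1) × Fin k × List (Fin d × Fin k))`:
`none` is the root, which has `d+1` child-hyperedges each containing `k` children; every
other vertex has `d` child-hyperedges each containing `k` children.  The root gets
`lam none · ∏_{i : Fin (d+1)} (1 + ∑_{j : Fin k} value of the subtree rooted at child (i,j))⁻¹`. -/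
noncomputable def rootR (d k : ℕ)
    (lam : Option (Fin (d + 1) × Fin k × List (Fin d × Fin k)) → ℝ)
    (b : ℝ≥0∞) (ℓ : ℕ) : ℝ≥0∞ :=
  ENNReal.ofReal (lam none) *
    ∏ i : Fin (d + 1), (1 + ∑ j : Fin k,
      subTreeR d k (fun w => lam (some (i, j, w))) b (ℓ - 1) [])⁻¹

section RealEstimates

/-- The slope `s = ((1+A)^d + μ) / ((1+a)^d + μ)` is at most the logarithmic slope
`A (1+a) / (a (1+A))` of the line through the origin and `(a, A)`. -/
lemma slope_mul_le {d : ℕ} {a A μ : ℝ} (ha : 0 ≤ a) (haA : a ≤ A) (hμ : 0 < μ)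
    (hA : μ ≤ A * (1 + a) ^ d) (haμ : a * (1 + A) ^ d ≤ μ) :
    ((1 + A) ^ d + μ) / ((1 + a) ^ d + μ) * (a * (1 + A)) ≤ A * (1 + a) := by
  have hP : 0 < (1 + a) ^ d + μ := by positivity
  rw [div_mul_eq_mul_div, div_le_iff₀ hP]
  have h₁ : (1 + A) * (a * (1 + A) ^ d) ≤ (1 + A) * μ :=
    mul_le_mul_of_nonneg_left haμ (by linarith)
  have h₂ : (1 + a) * μ ≤ (1 + a) * (A * (1 + a) ^ d) :=
    mul_le_mul_of_nonneg_left hA (by linarith)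
  nlinarith

/-- The region `X a ≤ A x`, `(1+X)/(1+x) ≤ (1+A)/(1+a)` lies below the power curve of exponent
`s` through `(1+a, 1+A)`. -/
lemma div_le_div_rpow {a A x X s : ℝ} (ha : 0 ≤ a) (haA : a ≤ A) (hx : 0 ≤ x)
    (hs : 1 ≤ s) (hsA : s * (a * (1 + A)) ≤ A * (1 + a))
    (h₁ : X * a ≤ A * x) (h₂ : (1 + X) * (1 + a) ≤ (1 + A) * (1 + x)) :
    (1 + X) / (1 + A) ≤ ((1 + x) / (1 + a)) ^ s := by
  have ha' : 0 < 1 + a := by linarith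
  have hA' : 0 < 1 + A := by linarith
  rcases le_or_gt a x with hax | hxa
  · calc (1 + X) / (1 + A) ≤ (1 + x) / (1 + a) := by
          rw [div_le_div_iff₀ hA' ha']; linarith
      _ ≤ ((1 + x) / (1 + a)) ^ s :=
          Real.self_le_rpow_of_one_le (by rw [le_div_iff₀ ha']; linarith) hs
  · have ha0 : 0 < a := by linarith
    have ht : -1 ≤ (x - a) / (1 + a) := by rw [le_div_iff₀ ha']; linarith
    have hb := one_add_mul_self_le_rpow_one_add ht hs
    have he : 1 + (x - a) / (1 + a) = (1 + x) / (1 + a) := by field_simp; ring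
    rw [he] at hb
    refine le_trans ?_ hb
    have he' : 1 + s * ((x - a) / (1 + a)) = ((1 + a) + s * (x - a)) / (1 + a) := by
      field_simp
    rw [he', div_le_div_iff₀ hA' ha']
    refine le_of_mul_le_mul_left ?_ ha0
    have h₃ : s * (a * (1 + A)) * (a - x) ≤ A * (1 + a) * (a - x) :=
      mul_le_mul_of_nonneg_right hsA (by linarith)
    have h₄ : X * a * (1 + a) ≤ A * x * (1 + a) := mul_le_mul_of_nonneg_right h₁ ha'.le
    nlinarith

/-- On the region below the power curve of exponent `s = (Q₀ + μ) / (P₀ + μ)` through `(P₀, Q₀)`,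
the ratio `(1 + μ/P) / (1 + μ/Q)` is maximal at `(P₀, Q₀)`. -/
lemma one_add_div_mul_le_of_le_rpow {P Q P₀ Q₀ μ s : ℝ} (hP : 0 < P) (hQ : 0 < Q)
    (hP₀ : 0 < P₀) (hQ₀ : 0 < Q₀) (hμ : 0 < μ) (hs : 1 ≤ s) (hs₀ : s * (P₀ + μ) = Q₀ + μ)
    (h : Q / Q₀ ≤ (P / P₀) ^ s) :
    (1 + μ / P) * (1 + μ / Q₀) ≤ (1 + μ / P₀) * (1 + μ / Q) := by
  have hb := one_add_mul_self_le_rpow_one_add (s := P₀ / P - 1)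
    (by have : 0 < P₀ / P := by positivity
        linarith) hs
  have he : 1 + (P₀ / P - 1) = (P / P₀)⁻¹ := by rw [inv_div]; ring
  rw [he, Real.inv_rpow (by positivity)] at hb
  have hq : ((P / P₀) ^ s)⁻¹ ≤ Q₀ / Q := by
    rw [← inv_div Q Q₀]
    exact inv_anti₀ (by positivity) h
  have hb' : 1 + s * (P₀ / P - 1) ≤ Q₀ / Q := hb.trans hq
  have key : s * (P₀ + μ * (P₀ / P)) ≤ Q₀ + μ * (Q₀ / Q) := by
    have := mul_le_mul_of_nonneg_left hb' hμ.le
    linarith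
  have key' : (Q₀ + μ) * (P₀ + μ * (P₀ / P)) ≤ (P₀ + μ) * (Q₀ + μ * (Q₀ / Q)) := by
    rw [← hs₀]
    have := mul_le_mul_of_nonneg_left key (by positivity : 0 ≤ P₀ + μ)
    linarith
  have e₁ : (1 + μ / P) * (1 + μ / Q₀) =
      (Q₀ + μ) * (P₀ + μ * (P₀ / P)) / (P₀ * Q₀) := by field_simp
  have e₂ : (1 + μ / P₀) * (1 + μ / Q) =
      (P₀ + μ) * (Q₀ + μ * (Q₀ / Q)) / (P₀ * Q₀) := by field_simp
  rw [e₁, e₂]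
  gcongr

/-- One step of the recursion for the ratio `(1 + R⁺) / (1 + R⁻)`. -/
lemma one_add_mul_prod_inv_le {d : ℕ} {a A μ ν : ℝ} {x X : Fin d → ℝ}
    (ha : 0 ≤ a) (haA : a ≤ A) (hμ : 0 < μ)
    (hA : μ ≤ A * (1 + a) ^ d) (haμ : a * (1 + A) ^ d ≤ μ)
    (hν₀ : 0 ≤ ν) (hν : ν ≤ μ) (hx : ∀ i, 0 ≤ x i) (hxX : ∀ i, x i ≤ X i)
    (h₁ : ∀ i, X i * a ≤ A * x i)
    (h₂ : ∀ i, (1 + X i) * (1 + a) ≤ (1 + A) * (1 + x i)) :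
    (1 + ν * ∏ i, (1 + x i)⁻¹) * (1 + μ * ((1 + A) ^ d)⁻¹) ≤
      (1 + μ * ((1 + a) ^ d)⁻¹) * (1 + ν * ∏ i, (1 + X i)⁻¹) := by
  have hx' : ∀ i, 0 < 1 + x i := fun i => by linarith [hx i]
  have hX' : ∀ i, 0 < 1 + X i := fun i => by linarith [hx i, hxX i]
  have hP : 0 < ∏ i, (1 + x i) := Finset.prod_pos fun i _ => hx' i
  have hQ : 0 < ∏ i, (1 + X i) := Finset.prod_pos fun i _ => hX' i
  have hPQ : ∏ i, (1 + x i) ≤ ∏ i, (1 + X i) :=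
    Finset.prod_le_prod (fun i _ => (hx' i).le) fun i _ => by linarith [hxX i]
  have ha' : 0 < 1 + a := by linarith
  have hA' : 0 < 1 + A := by linarith
  have hP₀ : 0 < (1 + a) ^ d := by positivity
  have hQ₀ : 0 < (1 + A) ^ d := by positivity
  have hPQ₀ : (1 + a) ^ d ≤ (1 + A) ^ d := by gcongr
  set s := ((1 + A) ^ d + μ) / ((1 + a) ^ d + μ) with hs_def
  have hs : 1 ≤ s := by rw [hs_def, one_le_div (by positivity)]; linarith
  have hprod : (∏ i, (1 + X i)) / (1 + A) ^ d ≤ ((∏ i, (1 + x i)) / (1 + a) ^ d) ^ s := by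
    have hc : ∀ (f : Fin d → ℝ) (c : ℝ), (∏ i, f i) / c ^ d = ∏ i, f i / c := fun f c => by
      simp [Finset.prod_div_distrib]
    rw [hc, hc, ← Real.finsetProd_rpow _ _ fun i _ => (div_pos (hx' i) ha').le]
    exact Finset.prod_le_prod (fun i _ => (div_pos (hX' i) hA').le) fun i _ =>
      div_le_div_rpow ha haA (hx i) hs (slope_mul_le ha haA hμ hA haμ) (h₁ i) (h₂ i)
  have hmain := one_add_div_mul_le_of_le_rpow hP hQ hP₀ hQ₀ hμ hs
    (div_mul_cancel₀ _ (by positivity)) hprod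
  simp only [div_eq_mul_inv] at hmain
  rw [Finset.prod_inv_distrib, Finset.prod_inv_distrib]
  set p := (∏ i, (1 + x i))⁻¹
  set q := (∏ i, (1 + X i))⁻¹
  set p₀ := ((1 + a) ^ d)⁻¹
  set q₀ := ((1 + A) ^ d)⁻¹
  have hqp : q ≤ p := inv_anti₀ hP hPQ
  have hqp₀ : q₀ ≤ p₀ := inv_anti₀ hP₀ hPQ₀
  rcases le_or_gt (p * (1 + μ * q₀)) ((1 + μ * p₀) * q) with hle | hlt
  · have hq₀' : μ * q₀ ≤ μ * p₀ := mul_le_mul_of_nonneg_left hqp₀ hμ.le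
    nlinarith [mul_le_mul_of_nonneg_left hle hν₀]
  · nlinarith [mul_le_mul_of_nonneg_right hν (sub_nonneg.2 hlt.le)]

end RealEstimates

section Recursion

variable {d k : ℕ}

lemma ofReal_mul_prod_inv {m : ℕ} {c : ℝ} (hc : 0 ≤ c) {f : Fin m → Fin k → ℝ≥0∞}
    (hf : ∀ i j, f i j ≠ ⊤) :
    ENNReal.ofReal c * ∏ i, (1 + ∑ j, f i j)⁻¹ =
      ENNReal.ofReal (c * ∏ i, (1 + ∑ j, (f i j).toReal)⁻¹) := by
  have hpos : ∀ i, 0 < 1 + ∑ j, (f i j).toReal := fun i => by positivity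
  rw [ENNReal.ofReal_mul hc, ENNReal.ofReal_prod_of_nonneg fun i _ => (inv_pos.2 (hpos i)).le]
  congr 1
  refine Finset.prod_congr rfl fun i _ => ?_
  rw [ENNReal.ofReal_inv_of_pos (hpos i), ENNReal.ofReal_add zero_le_one (by positivity),
    ENNReal.ofReal_one, ENNReal.ofReal_sum_of_nonneg fun j _ => ENNReal.toReal_nonneg]
  simp [ENNReal.ofReal_toReal (hf i _)]

lemma subTreeR_succ_ne_top (lam : List (Fin d × Fin k) → ℝ) (b : ℝ≥0∞) (n : ℕ)
    (v : List (Fin d × Fin k)) : subTreeR d k lam b (n + 1) v ≠ ⊤ := by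
  rw [subTreeR]
  exact ENNReal.mul_ne_top ENNReal.ofReal_ne_top
    (ENNReal.prod_ne_top fun i _ => ENNReal.inv_ne_top.2 (by simp))

lemma subTreeR_const (lam : ℝ) (b : ℝ≥0∞) (n : ℕ) (v : List (Fin d × Fin k)) :
    subTreeR d k (fun _ => lam) b n v = subTreeR d k (fun _ => lam) b n [] := by
  induction n generalizing v with
  | zero => rfl
  | succ n ih =>
    rw [subTreeR, subTreeR]
    simp_rw [ih (_ ++ _)]

/-- The real value at a node with remaining depth `n + 1` under the maximizing boundary. -/
noncomputable def upperR (d k : ℕ) (lam : List (Fin d × Fin k) → ℝ) (n : ℕ)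
    (v : List (Fin d × Fin k)) : ℝ :=
  (subTreeR d k lam (if Even (n + 1) then ⊤ else 0) (n + 1) v).toReal

/-- The real value at a node with remaining depth `n + 1` under the minimizing boundary. -/
noncomputable def lowerR (d k : ℕ) (lam : List (Fin d × Fin k) → ℝ) (n : ℕ)
    (v : List (Fin d × Fin k)) : ℝ :=
  (subTreeR d k lam (if Even (n + 1) then 0 else ⊤) (n + 1) v).toReal

variable {lam : List (Fin d × Fin k) → ℝ}

lemma upperR_zero (hlam : ∀ v, 0 ≤ lam v) (v : List (Fin d × Fin k)) :
    upperR d k lam 0 v = lam v := by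
  simp [upperR, subTreeR, hlam]

lemma lowerR_zero (hd : 1 ≤ d) (hk : 1 ≤ k) (v : List (Fin d × Fin k)) :
    lowerR d k lam 0 v = 0 := by
  have hd' : d ≠ 0 := by lia
  have hk' : (k : ℝ≥0∞) ≠ 0 := by simp; lia
  simp [lowerR, subTreeR, hd', ENNReal.mul_top hk']

lemma upperR_succ (hlam : ∀ v, 0 ≤ lam v) (n : ℕ) (v : List (Fin d × Fin k)) :
    upperR d k lam (n + 1) v =
      lam v * ∏ i, (1 + ∑ j, lowerR d k lam n (v ++ [(i, j)]))⁻¹ := by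
  have hb : (if Even (n + 1 + 1) then (⊤ : ℝ≥0∞) else 0) = if Even (n + 1) then 0 else ⊤ := by
    simp only [Nat.even_add_one (n := n + 1), ite_not]
  rw [upperR, hb, subTreeR, ofReal_mul_prod_inv (hlam v) fun _ _ => subTreeR_succ_ne_top _ _ _ _,
    ENNReal.toReal_ofReal]
  · rfl
  · have := hlam v
    positivity

lemma lowerR_succ (hlam : ∀ v, 0 ≤ lam v) (n : ℕ) (v : List (Fin d × Fin k)) :
    lowerR d k lam (n + 1) v =
      lam v * ∏ i, (1 + ∑ j, upperR d k lam n (v ++ [(i, j)]))⁻¹ := by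
  have hb : (if Even (n + 1 + 1) then (0 : ℝ≥0∞) else ⊤) = if Even (n + 1) then ⊤ else 0 := by
    simp only [Nat.even_add_one (n := n + 1), ite_not]
  rw [lowerR, hb, subTreeR, ofReal_mul_prod_inv (hlam v) fun _ _ => subTreeR_succ_ne_top _ _ _ _,
    ENNReal.toReal_ofReal]
  · rfl
  · have := hlam v
    positivity

lemma lowerR_nonneg (n : ℕ) (v : List (Fin d × Fin k)) : 0 ≤ lowerR d k lam n v :=
  ENNReal.toReal_nonneg

lemma upperR_nonneg (n : ℕ) (v : List (Fin d × Fin k)) : 0 ≤ upperR d k lam n v :=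
  ENNReal.toReal_nonneg

lemma lowerR_le_upperR (hd : 1 ≤ d) (hk : 1 ≤ k) (hlam : ∀ v, 0 ≤ lam v) (n : ℕ)
    (v : List (Fin d × Fin k)) : lowerR d k lam n v ≤ upperR d k lam n v := by
  induction n generalizing v with
  | zero => rw [lowerR_zero hd hk, upperR_zero hlam]; exact hlam v
  | succ n ih =>
    rw [lowerR_succ hlam, upperR_succ hlam]
    have h₀ : ∀ i, 0 ≤ ∑ j, lowerR d k lam n (v ++ [(i, j)]) :=
      fun i => Finset.sum_nonneg fun j _ => lowerR_nonneg ..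
    have h₁ : ∀ i, ∑ j, lowerR d k lam n (v ++ [(i, j)]) ≤
        ∑ j, upperR d k lam n (v ++ [(i, j)]) :=
      fun i => Finset.sum_le_sum fun j _ => ih _
    refine mul_le_mul_of_nonneg_left (Finset.prod_le_prod (fun i _ => ?_) fun i _ => ?_) (hlam v)
    · exact inv_nonneg.2 (by linarith [h₀ i, h₁ i])
    · exact inv_anti₀ (by linarith [h₀ i]) (by linarith [h₁ i])

/-- The maximal value at a node of the uniform tree. -/
noncomputable abbrev uniformUpper (d k : ℕ) (lam : ℝ) (n : ℕ) : ℝ :=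
  upperR d k (fun _ => lam) n []

/-- The minimal value at a node of the uniform tree. -/
noncomputable abbrev uniformLower (d k : ℕ) (lam : ℝ) (n : ℕ) : ℝ :=
  lowerR d k (fun _ => lam) n []

lemma uniformUpper_succ {lam : ℝ} (hlam : 0 ≤ lam) (n : ℕ) :
    uniformUpper d k lam (n + 1) = lam * ((1 + k * uniformLower d k lam n) ^ d)⁻¹ := by
  rw [uniformUpper, upperR_succ fun _ => hlam]
  simp [lowerR, subTreeR_const lam _ _ [_]]

lemma uniformLower_succ {lam : ℝ} (hlam : 0 ≤ lam) (n : ℕ) :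
    uniformLower d k lam (n + 1) = lam * ((1 + k * uniformUpper d k lam n) ^ d)⁻¹ := by
  rw [uniformLower, lowerR_succ fun _ => hlam]
  simp [upperR, subTreeR_const lam _ _ [_]]

lemma uniform_monotone (hd : 1 ≤ d) (hk : 1 ≤ k) {lam : ℝ} (hlam : 0 ≤ lam) (n : ℕ) :
    uniformUpper d k lam (n + 1) ≤ uniformUpper d k lam n ∧
      uniformLower d k lam n ≤ uniformLower d k lam (n + 1) := by
  induction n with
  | zero =>
    refine ⟨?_, by rw [uniformLower, lowerR_zero hd hk]; exact lowerR_nonneg ..⟩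
    rw [uniformUpper_succ hlam, uniformUpper, upperR_zero fun _ => hlam, uniformLower,
      lowerR_zero hd hk]
    simp
  | succ n ih =>
    obtain ⟨hU, hL⟩ := ih
    have h₁ := lowerR_nonneg (lam := fun _ : List (Fin d × Fin k) => lam) n []
    have h₂ := upperR_nonneg (lam := fun _ : List (Fin d × Fin k) => lam) (n + 1) []
    constructor
    · rw [uniformUpper_succ hlam (n + 1), uniformUpper_succ hlam n]
      gcongr
    · rw [uniformLower_succ hlam (n + 1), uniformLower_succ hlam n]
      gcongr

/-- `R⁺(λ⃗) / R⁻(λ⃗)` and `(1 + k R⁺(λ⃗)) / (1 + k R⁻(λ⃗))` are bounded by their uniform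
counterparts. -/
def RatioDominated (d k : ℕ) (lam : ℝ) (n : ℕ) (B b : ℝ) : Prop :=
  B * uniformLower d k lam n ≤ uniformUpper d k lam n * b ∧
    (1 + k * B) * (1 + k * uniformLower d k lam n) ≤
      (1 + k * uniformUpper d k lam n) * (1 + k * b)

lemma RatioDominated.sum {lam : ℝ} {n : ℕ} (hk : 1 ≤ k) {B b : Fin k → ℝ}
    (h : ∀ j, RatioDominated d k lam n (B j) (b j)) :
    (∑ j, B j) * (k * uniformLower d k lam n) ≤ k * uniformUpper d k lam n * ∑ j, b j ∧
      (1 + ∑ j, B j) * (1 + k * uniformLower d k lam n) ≤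
        (1 + k * uniformUpper d k lam n) * (1 + ∑ j, b j) := by
  have hk' : (0 : ℝ) < k := by exact_mod_cast hk
  have h₁ := Finset.sum_le_sum fun j (_ : j ∈ Finset.univ) => (h j).1
  have h₂ := Finset.sum_le_sum fun j (_ : j ∈ Finset.univ) => (h j).2
  simp only [← Finset.sum_mul, ← Finset.mul_sum, Finset.sum_add_distrib, Finset.sum_const,
    Finset.card_univ, Fintype.card_fin, nsmul_eq_mul, mul_one] at h₁ h₂
  constructor
  · linarith [mul_le_mul_of_nonneg_left h₁ hk'.le]
  · refine le_of_mul_le_mul_left ?_ hk'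
    linarith

lemma mul_prod_inv_mul_le {m : ℕ} {c c₀ a A : ℝ} {x X : Fin m → ℝ} (hc : 0 ≤ c) (hc₀ : 0 ≤ c₀)
    (ha : 0 ≤ a) (hA : 0 ≤ A) (hx : ∀ i, 0 ≤ x i) (hX : ∀ i, 0 ≤ X i)
    (h : ∀ i, (1 + X i) * (1 + a) ≤ (1 + A) * (1 + x i)) :
    (c * ∏ i, (1 + x i)⁻¹) * (c₀ * ((1 + A) ^ m)⁻¹) ≤
      (c₀ * ((1 + a) ^ m)⁻¹) * (c * ∏ i, (1 + X i)⁻¹) := by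
  have hp : (∏ i, (1 + x i)⁻¹) * ((1 + A) ^ m)⁻¹ ≤ ((1 + a) ^ m)⁻¹ * ∏ i, (1 + X i)⁻¹ := by
    have he : ∀ (f : Fin m → ℝ) (t : ℝ), (∏ i, f i) * (t ^ m)⁻¹ = ∏ i, f i * t⁻¹ := fun f t => by
      simp [Finset.prod_mul_distrib]
    rw [mul_comm (((1 + a) ^ m)⁻¹), he, he]
    refine Finset.prod_le_prod (fun i _ => ?_) fun i _ => ?_
    · have := hx i
      positivity
    · have h₁ := hx i
      have h₂ := hX i
      rw [← mul_inv, ← mul_inv]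
      exact inv_anti₀ (by positivity) (by linarith [h i])
  calc _ = c * c₀ * ((∏ i, (1 + x i)⁻¹) * ((1 + A) ^ m)⁻¹) := by ring
    _ ≤ c * c₀ * (((1 + a) ^ m)⁻¹ * ∏ i, (1 + X i)⁻¹) := by gcongr
    _ = _ := by ring

lemma ratioDominated (hd : 1 ≤ d) (hk : 1 ≤ k) {lam₀ : ℝ} (hlam₀ : 0 < lam₀)
    (hlam : ∀ v, 0 ≤ lam v ∧ lam v ≤ lam₀) (n : ℕ) (v : List (Fin d × Fin k)) :
    RatioDominated d k lam₀ n (upperR d k lam n v) (lowerR d k lam n v) := by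
  have hk' : (0 : ℝ) < k := by exact_mod_cast hk
  have hl : ∀ v, 0 ≤ lam v := fun v => (hlam v).1
  induction n generalizing v with
  | zero =>
    rw [RatioDominated, uniformLower, uniformUpper, lowerR_zero hd hk, lowerR_zero hd hk,
      upperR_zero hl, upperR_zero fun _ => hlam₀.le]
    refine ⟨by simp, ?_⟩
    have := mul_le_mul_of_nonneg_left (hlam v).2 hk'.le
    linarith
  | succ n ih =>
    have hsum := fun i => RatioDominated.sum hk fun j => ih (v ++ [(i, j)])
    have hx : ∀ i, 0 ≤ ∑ j, lowerR d k lam n (v ++ [(i, j)]) :=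
      fun i => Finset.sum_nonneg fun j _ => lowerR_nonneg ..
    have hxX : ∀ i, ∑ j, lowerR d k lam n (v ++ [(i, j)]) ≤
        ∑ j, upperR d k lam n (v ++ [(i, j)]) :=
      fun i => Finset.sum_le_sum fun j _ => lowerR_le_upperR hd hk hl ..
    obtain ⟨hU, hL⟩ := uniform_monotone hd hk hlam₀.le n
    have ha : 0 ≤ uniformLower d k lam₀ n := lowerR_nonneg ..
    have haA : uniformLower d k lam₀ n ≤ uniformUpper d k lam₀ n :=
      lowerR_le_upperR hd hk (fun _ => hlam₀.le) ..
    rw [RatioDominated, uniformUpper_succ hlam₀.le, uniformLower_succ hlam₀.le, upperR_succ hl,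
      lowerR_succ hl]
    rw [uniformUpper_succ hlam₀.le] at hU
    rw [uniformLower_succ hlam₀.le] at hL
    set a := uniformLower d k lam₀ n
    set A := uniformUpper d k lam₀ n
    have hA : 0 ≤ A := ha.trans haA
    refine ⟨mul_prod_inv_mul_le (hl v) hlam₀.le (by positivity) (by positivity) hx
      (fun i => (hx i).trans (hxX i)) fun i => (hsum i).2, ?_⟩
    rw [← div_eq_mul_inv, div_le_iff₀ (by positivity)] at hU
    rw [← div_eq_mul_inv, le_div_iff₀ (by positivity)] at hL
    have := one_add_mul_prod_inv_le (d := d) (a := k * a) (A := k * A) (μ := k * lam₀)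
      (ν := k * lam v) (by positivity) (by gcongr) (by positivity)
      (by rw [mul_assoc]; gcongr) (by rw [mul_assoc]; gcongr)
      (mul_nonneg hk'.le (hl v)) (by gcongr; exact (hlam v).2) hx hxX
      (fun i => (hsum i).1) (fun i => (hsum i).2)
    simpa only [mul_assoc] using this

lemma rootR_eq_ofReal {lamv : Option (Fin (d + 1) × Fin k × List (Fin d × Fin k)) → ℝ}
    (hroot : 0 ≤ lamv none) (b : ℝ≥0∞) (n : ℕ) :
    rootR d k lamv b (n + 2) = ENNReal.ofReal (lamv none * ∏ i, (1 + ∑ j,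
      (subTreeR d k (fun w => lamv (some (i, j, w))) b (n + 1) []).toReal)⁻¹) :=
  ofReal_mul_prod_inv hroot fun _ _ => subTreeR_succ_ne_top _ _ _ _

end Recursion

/-- for every `ℓ ≥ 1` and every activity assignment `λ⃗` on the
`(k+1)`-uniform `(d+1)`-regular hypertree with `0 ≤ λ⃗(v) ≤ λ`, with `R⁺_ℓ(λ⃗)` the root
value for boundary `∞` when `ℓ` is even and `0` when `ℓ` is odd, `R⁻_ℓ(λ⃗)` the root value
for the opposite boundary, and `R⁺_ℓ, R⁻_ℓ` the values for the constant assignment `λ⃗ ≡ λ`,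
the cross-multiplied inequality `R⁺_ℓ(λ⃗)·R⁻_ℓ ≤ R⁺_ℓ·R⁻_ℓ(λ⃗)` holds. -/
theorem stmt13 (d k : ℕ) (hd : 1 ≤ d) (hk : 1 ≤ k) (lam : ℝ) (hlam : 0 < lam)
    (lamv : Option (Fin (d + 1) × Fin k × List (Fin d × Fin k)) → ℝ)
    (hlamv : ∀ v, 0 ≤ lamv v ∧ lamv v ≤ lam)
    (ℓ : ℕ) (hℓ : 1 ≤ ℓ) :
    rootR d k lamv (if Even ℓ then ⊤ else 0) ℓ *
        rootR d k (fun _ => lam) (if Even ℓ then 0 else ⊤) ℓ ≤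
      rootR d k (fun _ => lam) (if Even ℓ then ⊤ else 0) ℓ *
        rootR d k lamv (if Even ℓ then 0 else ⊤) ℓ := by
  obtain rfl | ⟨n, rfl⟩ : ℓ = 1 ∨ ∃ n, ℓ = n + 2 := by
    rcases ℓ with _ | _ | n
    · lia
    · exact .inl rfl
    · exact .inr ⟨n, rfl⟩
  · have hk' : (k : ℝ≥0∞) ≠ 0 := by simp; lia
    simp [rootR, subTreeR, ENNReal.mul_top hk']
  have hb : ∀ s t : ℝ≥0∞, (if Even (n + 2) then s else t) = if Even (n + 1) then t else s := by
    intro s t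
    simp only [Nat.even_add_one (n := n + 1), ite_not]
  have hroot := (hlamv none).1
  have hsub : ∀ i j v, 0 ≤ lamv (some (i, j, v)) ∧ lamv (some (i, j, v)) ≤ lam :=
    fun i j v => hlamv _
  simp only [hb, rootR_eq_ofReal hroot, rootR_eq_ofReal (lamv := fun _ => lam) hlam.le]
  have hsum := fun i => RatioDominated.sum hk fun j => ratioDominated hd hk hlam (hsub i j) n []
  have ha : 0 ≤ uniformLower d k lam n := lowerR_nonneg ..
  have hA : 0 ≤ uniformUpper d k lam n := upperR_nonneg ..
  rw [← ENNReal.ofReal_mul (by positivity), ← ENNReal.ofReal_mul (by positivity)]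
  refine ENNReal.ofReal_le_ofReal ?_
  have := mul_prod_inv_mul_le hroot hlam.le (by positivity) (by positivity)
    (fun i => Finset.sum_nonneg fun j _ => lowerR_nonneg ..)
    (fun i => Finset.sum_nonneg fun j _ => upperR_nonneg ..) fun i => (hsum i).2
  simpa [upperR, lowerR] using this
end
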